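/- Let p and q be distinct odd primes, n = p²q³, and D* = {1, p², pq, q², p²q², pq³}. Then the eigenvalue at the divisor q³ satisfies λ_{q³}(D*) = ∑_{d ∈ D*} c(q³, n/d) = q³ - 2q² + 2q - 2 (equality in ℂ with the integer right-hand side coerced). -/

import Mathlib

/-- The Ramanujan sum `c(j, m) = ∑_{a=1, gcd(a,m)=1}^{m} exp(2πi·a·j/m)`. -/
noncomputable def ramanujanSum (j m : ℕ) : ℂ :=
  ∑ a ∈ (Finset.Icc 1 m).filter (fun a => Nat.gcd a m = 1),
    Complex.exp (2 * (Real.pi : ℂ) * Complex.I * (a : ℂ) * (j : ℂ) / (m : ℂ))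

/-- The divisor set `D* = {1, p², pq, q², p²q², pq³}`. -/
def Dstar (p q : ℕ) : Finset ℕ :=
  {1, p ^ 2, p * q, q ^ 2, p ^ 2 * q ^ 2, p * q ^ 3}

/-- The eigenvalue `λ_e(D*) = ∑_{d ∈ D*} c(e, n/d)` of `ICG(p²q³, D*)`. -/
noncomputable def lamStar (p q e : ℕ) : ℂ :=
  ∑ d ∈ Dstar p q, ramanujanSum e (p ^ 2 * q ^ 3 / d)

theorem ram_full (j m : ℕ) (hm : 0 < m) :
    ∑ a ∈ Finset.Icc 1 m,
      Complex.exp (2 * (Real.pi : ℂ) * Complex.I * (a : ℂ) * (j : ℂ) / (m : ℂ))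
      = if m ∣ j then (m : ℂ) else 0 := by
  have hm0 : (m : ℂ) ≠ 0 := by exact_mod_cast hm.ne'
  set z : ℂ := Complex.exp (2 * (Real.pi : ℂ) * Complex.I * (j : ℂ) / (m : ℂ)) with hz
  have hpow : ∀ a : ℕ, Complex.exp (2 * (Real.pi : ℂ) * Complex.I * (a : ℂ) * (j : ℂ) / (m : ℂ))
      = z ^ a := by
    intro a
    rw [hz, ← Complex.exp_nat_mul]
    congr 1
    ring
  have hz' : z = Complex.exp (2 * (Real.pi : ℂ) * Complex.I / (m : ℂ)) ^ j := by
    rw [hz, ← Complex.exp_nat_mul]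
    congr 1
    ring
  have hprim := Complex.isPrimitiveRoot_exp m hm.ne'
  have hzm : z ^ m = 1 := by
    rw [hz', ← pow_mul, mul_comm j m, pow_mul, hprim.pow_eq_one, one_pow]
  simp_rw [hpow]
  split_ifs with h
  · have : z = 1 := by rw [hz', hprim.pow_eq_one_iff_dvd]; exact h
    simp [this]
  · have h1 : z ≠ 1 := by
      intro h1
      rw [hz', hprim.pow_eq_one_iff_dvd] at h1
      exact h h1
    have hg := geom_sum_eq h1 m
    rw [hzm, sub_self, zero_div] at hg
    have h2 : ∑ a ∈ Finset.Icc 1 m, z ^ a = z * ∑ a ∈ Finset.range m, z ^ a := by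
      rw [Finset.range_eq_Ico, Finset.mul_sum,
        show Finset.Icc 1 m = Finset.Ico (0 + 1) (m + 1) by ext; simp,
        ← Finset.sum_Ico_add']
      exact Finset.sum_congr rfl fun a _ => by ring
    rw [h2, hg, mul_zero]

theorem ram_div (j m : ℕ) (hm : 0 < m) :
    ∑ d ∈ m.divisors, ramanujanSum j d = if m ∣ j then (m : ℂ) else 0 := by
  rw [← ram_full j m hm, ← Nat.sum_div_divisors,
    ← Finset.sum_fiberwise_of_maps_to (s := Finset.Icc 1 m) (t := m.divisors)
      (g := fun a => Nat.gcd a m)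
      (fun a _ => Nat.mem_divisors.2 ⟨Nat.gcd_dvd_right a m, hm.ne'⟩)]
  refine Finset.sum_congr rfl fun d hd => ?_
  obtain ⟨k, rfl⟩ := Nat.dvd_of_mem_divisors hd
  have hd0 : 0 < d := Nat.pos_of_mul_pos_right hm
  have hk0 : 0 < k := Nat.pos_of_mul_pos_left hm
  rw [Nat.mul_div_cancel_left k hd0]
  unfold ramanujanSum
  refine Finset.sum_bij (fun a _ => d * a) ?_ ?_ ?_ ?_
  · intro a ha
    simp only [Finset.mem_filter, Finset.mem_Icc] at ha ⊢
    refine ⟨⟨Nat.mul_pos hd0 ha.1.1, Nat.mul_le_mul_left d ha.1.2⟩, ?_⟩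
    rw [Nat.gcd_mul_left, ha.2, mul_one]
  · intro a _ b _ h
    exact Nat.eq_of_mul_eq_mul_left hd0 h
  · intro b hb
    simp only [Finset.mem_filter, Finset.mem_Icc] at hb
    obtain ⟨a, rfl⟩ : d ∣ b := by rw [← hb.2]; exact Nat.gcd_dvd_left _ _
    refine ⟨a, ?_, rfl⟩
    simp only [Finset.mem_filter, Finset.mem_Icc]
    refine ⟨⟨Nat.pos_of_mul_pos_left hb.1.1, Nat.le_of_mul_le_mul_left hb.1.2 hd0⟩, ?_⟩
    have := hb.2
    rw [Nat.gcd_mul_left] at this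
    exact Nat.eq_of_mul_eq_mul_left hd0 (by rw [this, mul_one])
  · intro a _
    congr 1
    have h1 : (d : ℂ) ≠ 0 := by exact_mod_cast hd0.ne'
    have h2 : (k : ℂ) ≠ 0 := by exact_mod_cast hk0.ne'
    push_cast
    field_simp

theorem ram_grid (p q : ℕ) (hp : p.Prime) (hq : q.Prime) (hpq : p ≠ q) (j a b : ℕ) :
    ∑ i ∈ Finset.range (a + 1), ∑ k ∈ Finset.range (b + 1), ramanujanSum j (p ^ i * q ^ k)
      = if p ^ a * q ^ b ∣ j then ((p ^ a * q ^ b : ℕ) : ℂ) else 0 := by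
  rw [← ram_div j _ (Nat.mul_pos (pow_pos hp.pos a) (pow_pos hq.pos b)),
    ← Finset.sum_product']
  refine Finset.sum_bij (fun x _ => p ^ x.1 * q ^ x.2) ?_ ?_ ?_ ?_
  · rintro ⟨i, k⟩ h
    simp only [Finset.mem_product, Finset.mem_range] at h
    exact Nat.mem_divisors.2 ⟨Nat.mul_dvd_mul (pow_dvd_pow p (by omega)) (pow_dvd_pow q (by omega)),
      (Nat.mul_pos (pow_pos hp.pos a) (pow_pos hq.pos b)).ne'⟩
  · rintro ⟨i, k⟩ _ ⟨i', k'⟩ _ h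
    have hv : ∀ i k : ℕ, (p ^ i * q ^ k).factorization p = i ∧
        (p ^ i * q ^ k).factorization q = k := by
      intro i k
      rw [Nat.factorization_mul (pow_pos hp.pos i).ne' (pow_pos hq.pos k).ne',
        hp.factorization_pow, hq.factorization_pow]
      simp [hpq, hpq.symm]
    have h1 := hv i k
    simp only at h
    rw [h] at h1
    have h2 := hv i' k'
    rw [Prod.mk.injEq]
    omega
  · intro d hd
    obtain ⟨x, y, hx, hy, rfl⟩ := (Nat.dvd_mul).1 (Nat.dvd_of_mem_divisors hd)
    obtain ⟨i, hi, rfl⟩ := (Nat.dvd_prime_pow hp).1 hx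
    obtain ⟨k, hk, rfl⟩ := (Nat.dvd_prime_pow hq).1 hy
    exact ⟨(i, k), by simp; omega, rfl⟩
  · intro _ _
    rfl

theorem stmt7 (p q : ℕ) (hp : p.Prime) (hq : q.Prime)
    (hpo : Odd p) (hqo : Odd q) (hpq : p ≠ q) :
    lamStar p q (q ^ 3)
      = (((q : ℤ) ^ 3 - 2 * (q : ℤ) ^ 2 + 2 * (q : ℤ) - 2 : ℤ) : ℂ) := by
  have hp0 := hp.pos
  have hq0 := hq.pos
  have hnd : ∀ a b : ℕ, ¬ (p ^ (a + 1) * q ^ b ∣ q ^ 3) := by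
    intro a b h
    have h1 : p ∣ q ^ 3 := (Dvd.dvd.mul_right (dvd_pow_self p (Nat.succ_ne_zero a)) _).trans h
    exact hpq ((Nat.prime_dvd_prime_iff_eq hp hq).1 (hp.dvd_of_dvd_pow h1))
  have G := ram_grid p q hp hq hpq (q ^ 3)
  have G1 : ∀ a b, ∑ i ∈ Finset.range (a + 1 + 1), ∑ k ∈ Finset.range (b + 1),
      ramanujanSum (q ^ 3) (p ^ i * q ^ k) = 0 := by
    intro a b
    rw [G, if_neg (hnd a b)]
  have G0 : ∀ b, b ≤ 3 → ∑ k ∈ Finset.range (b + 1),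
      ramanujanSum (q ^ 3) (q ^ k) = (q : ℂ) ^ b := by
    intro b hb
    have := G 0 b
    rw [if_pos (by simpa using pow_dvd_pow q hb)] at this
    simpa using this
  have hD : lamStar p q (q ^ 3) = ramanujanSum (q ^ 3) (p ^ 2 * q ^ 3)
      + ramanujanSum (q ^ 3) (q ^ 3) + ramanujanSum (q ^ 3) (p * q ^ 2)
      + ramanujanSum (q ^ 3) (p ^ 2 * q) + ramanujanSum (q ^ 3) q
      + ramanujanSum (q ^ 3) p := by
    have hpd : ∀ x, q ^ 2 ≠ p * x := fun x h =>
      hpq ((Nat.prime_dvd_prime_iff_eq hp hq).1 (hp.dvd_of_dvd_pow ⟨x, h⟩))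
    have hqd : ∀ x, p ^ 2 ≠ q * x := fun x h =>
      hpq ((Nat.prime_dvd_prime_iff_eq hq hp).1 (hq.dvd_of_dvd_pow ⟨x, h⟩)).symm
    have hp1 := hp.one_lt
    have hq1 := hq.one_lt
    have e1 : p ^ 2 * q ^ 3 / p ^ 2 = q ^ 3 := Nat.div_eq_of_eq_mul_right (by positivity) (by ring)
    have e2 : p ^ 2 * q ^ 3 / (p * q) = p * q ^ 2 :=
      Nat.div_eq_of_eq_mul_right (by positivity) (by ring)
    have e3 : p ^ 2 * q ^ 3 / q ^ 2 = p ^ 2 * q :=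
      Nat.div_eq_of_eq_mul_right (by positivity) (by ring)
    have e4 : p ^ 2 * q ^ 3 / (p ^ 2 * q ^ 2) = q :=
      Nat.div_eq_of_eq_mul_right (by positivity) (by ring)
    have e5 : p ^ 2 * q ^ 3 / (p * q ^ 3) = p :=
      Nat.div_eq_of_eq_mul_right (by positivity) (by ring)
    have n1 : 1 ∉ ({p ^ 2, p * q, q ^ 2, p ^ 2 * q ^ 2, p * q ^ 3} : Finset ℕ) := by
      simp only [Finset.mem_insert, Finset.mem_singleton, not_or]
      refine ⟨?_, ?_, ?_, ?_, ?_⟩ <;> intro h <;> symm at h <;>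
        simp [hp1.ne', hq1.ne'] at h
    have n2 : p ^ 2 ∉ ({p * q, q ^ 2, p ^ 2 * q ^ 2, p * q ^ 3} : Finset ℕ) := by
      simp only [Finset.mem_insert, Finset.mem_singleton, not_or]
      exact ⟨fun h => hqd p (by rw [h]; ring), fun h => hqd q (by rw [h]; ring),
        fun h => hqd (p ^ 2 * q) (by nth_rewrite 1 [h]; ring),
        fun h => hqd (p * q ^ 2) (by rw [h]; ring)⟩
    have n3 : p * q ∉ ({q ^ 2, p ^ 2 * q ^ 2, p * q ^ 3} : Finset ℕ) := by
      simp only [Finset.mem_insert, Finset.mem_singleton, not_or]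
      refine ⟨fun h => hpd q h.symm, fun h => ?_, fun h => ?_⟩
      · have : 1 = p * q := Nat.eq_of_mul_eq_mul_left (Nat.mul_pos hp0 hq0) (by linarith)
        nlinarith
      · have : 1 = q ^ 2 := Nat.eq_of_mul_eq_mul_left (Nat.mul_pos hp0 hq0) (by linarith)
        nlinarith
    have n4 : q ^ 2 ∉ ({p ^ 2 * q ^ 2, p * q ^ 3} : Finset ℕ) := by
      simp only [Finset.mem_insert, Finset.mem_singleton, not_or]
      exact ⟨fun h => hpd (p * q ^ 2) (by nth_rewrite 1 [h]; ring),
        fun h => hpd (q ^ 3) h⟩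
    have n5 : p ^ 2 * q ^ 2 ∉ ({p * q ^ 3} : Finset ℕ) := by
      simp only [Finset.mem_singleton]
      intro h
      exact hpq (Nat.eq_of_mul_eq_mul_left (Nat.mul_pos hp0 (pow_pos hq0 2)) (by linarith))
    unfold lamStar Dstar
    rw [Finset.sum_insert n1, Finset.sum_insert n2, Finset.sum_insert n3, Finset.sum_insert n4,
      Finset.sum_insert n5, Finset.sum_singleton, e1, e2, e3, e4, e5, Nat.div_one]
    ring
  have a0 := G0 0 (by norm_num)
  have a1 := G0 1 (by norm_num)
  have a2 := G0 2 (by norm_num)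
  have a3 := G0 3 (by norm_num)
  have b0 := G1 0 0
  have b1 := G1 0 1
  have b2 := G1 0 2
  have b3 := G1 0 3
  have c0 := G1 1 0
  have c1 := G1 1 1
  have c2 := G1 1 2
  have c3 := G1 1 3
  simp only [Finset.sum_range_succ, Finset.sum_range_zero, zero_add, pow_zero, pow_one, one_mul,
    mul_one] at a0 a1 a2 a3 b0 b1 b2 b3 c0 c1 c2 c3
  rw [hD]
  push_cast
  linear_combination (c3 - b3 - c2 + b2) + (a3 - a2) + (b2 - a2 - b1 + a1) + (c1 - b1 - c0 + b0) + (a1 - a0) + (b0 - a0)
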